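/- If the Dyck path a is a product (concatenation) of pyramids, then for every k ≥ 0, f(u^k a d^k) = ζ^{k+1}(a, u^{|a|/2} d^{|a|/2}), i.e., f(u^k a d^k) equals the number of multichains of length k+1 from a to the pyramid u^{|a|/2} d^{|a|/2} in the lattice of binary paths of length |a|. -/

import Mathlib

/-- A binary path is a list of steps: `true` = upstep `u`, `false` = downstep `d`. -/
abbrev BinPath := List Bool

/-- `ht P k` is the height of the `k`-th point of the path `P` (the point reached
after the first `k` steps). -/
def ht (P : BinPath) (k : ℕ) : ℤ :=
  ((P.take k).map (fun b => if b then (1 : ℤ) else -1)).sum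

/-- The lattice order on binary paths of the same length: `P ≤ Q` iff
`hᵢ(P) ≤ hᵢ(Q)` for all `i`. -/
def pathLe (P Q : BinPath) : Prop :=
  P.length = Q.length ∧ ∀ k, ht P k ≤ ht Q k

def pathLt (P Q : BinPath) : Prop := pathLe P Q ∧ P ≠ Q

/-- The maximum path `1ₙ = uⁿ`. -/
def maxPath (n : ℕ) : BinPath := List.replicate n true

/-- Step `i` (0-based) of `P` is a downstep whose endpoint is a valley, i.e. it is
followed by an upstep or it is the last step of `P`. -/
def isValley (P : BinPath) (i : ℕ) : Prop :=
  i < P.length ∧ P.getD i true = false ∧ P.getD (i + 1) true = true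

/-- The number of valleys of `P`. -/
def numValleys (P : BinPath) : ℕ :=
  ((Finset.range P.length).filter
    (fun i => P.getD i true = false ∧ P.getD (i + 1) true = true)).card

/-- The filling of `P`: every valley of `P` is turned into a peak
(each occurrence `du` whose middle point is a valley becomes `ud`, and a final
valley-`d` becomes `u`). -/
def fill (P : BinPath) : BinPath :=
  List.ofFn (fun i : Fin P.length =>
    if P.get i then P.getD (i.1 - 1) true else P.getD (i.1 + 1) true)

/-- The degree of `P`: the least `k` such that the `k`-fold iterated filling
of `P` is the maximum path. -/
noncomputable def degree (P : BinPath) : ℕ :=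
  sInf {k | fill^[k] P = maxPath P.length}

/-- `fPath P` is the number of chains from `P` to the maximum path `1_{|P|}` of
length `degree P` having small intervals. -/
noncomputable def fPath (P : BinPath) : ℕ :=
  Set.ncard {c : ℕ → BinPath |
    c 0 = P ∧ (∀ i, degree P ≤ i → c i = maxPath P.length) ∧
    ∀ i < degree P, pathLt (c i) (c (i + 1)) ∧ pathLe (c (i + 1)) (fill (c i))}

/-- Height of the lowest valley of `P`. -/
noncomputable def lv (P : BinPath) : ℤ :=
  sInf {h : ℤ | ∃ i, isValley P i ∧ ht P (i + 1) = h}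

/-- Height of the highest valley of `P`. -/
noncomputable def hv (P : BinPath) : ℤ :=
  sSup {h : ℤ | ∃ i, isValley P i ∧ ht P (i + 1) = h}

noncomputable def hvNat (P : BinPath) : ℕ := (hv P).toNat

/-- `P′`: every low valley of `P` is turned into a peak. -/
noncomputable def lowFill (P : BinPath) : BinPath :=
  List.ofFn (fun i : Fin P.length =>
    if P.get i then
      (if P.getD (i.1 - 1) true = false ∧ ht P i.1 = lv P then false else true)
    else
      (if P.getD (i.1 + 1) true = true ∧ ht P (i.1 + 1) = lv P then true else false))

/-- `P*`: every valley of `P` is turned into a peak, except the last one when `P`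
ends with a downstep. -/
def starFill (P : BinPath) : BinPath :=
  List.ofFn (fun i : Fin P.length =>
    if i.1 + 1 = P.length ∧ P.get i = false then false
    else if P.get i then P.getD (i.1 - 1) true else P.getD (i.1 + 1) true)

/-- A Dyck path: starts and ends at height 0 and lies weakly above height 0. -/
def IsDyck (P : BinPath) : Prop := ht P P.length = 0 ∧ ∀ k, 0 ≤ ht P k

/-- A Dyck prefix: a prefix of a Dyck path. -/
def IsDyckPrefix (P : BinPath) : Prop := ∃ Q : BinPath, IsDyck (P ++ Q)

/-- A Dyck suffix: a suffix of a Dyck path. -/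
def IsDyckSuffix (P : BinPath) : Prop := ∃ Q : BinPath, IsDyck (Q ++ P)

/-- The pyramid `u^m d^m`. -/
def pyramid (m : ℕ) : BinPath := List.replicate m true ++ List.replicate m false

/-- Cardinality of the interval `[P, Q]` in the lattice of binary paths. -/
noncomputable def intervalCard (P Q : BinPath) : ℕ :=
  Set.ncard {R : BinPath | pathLe P R ∧ pathLe R Q}

/-- `I(s) = |[s, u^{|s|/2} d^{|s|/2}]|`. -/
noncomputable def Ifun (s : BinPath) : ℕ := intervalCard s (pyramid (s.length / 2))

/-- `J(P) = |[P, u^{|P|}]|`. -/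
noncomputable def Jfun (P : BinPath) : ℕ := intervalCard P (maxPath P.length)

/-- `P` and `Q` have exactly the same valleys at every height at most `m`. -/
def sameValleysUpTo (P Q : BinPath) (m : ℤ) : Prop :=
  ∀ (i : ℕ) (t : ℤ), t ≤ m →
    ((isValley P i ∧ ht P (i + 1) = t) ↔ (isValley Q i ∧ ht Q (i + 1) = t))

/-- A multichain of Dyck paths of type `V` from `a` to `s`: it has length
`h = hv(a)` and for every `j ∈ [h]` its `(j-1)`-st and `j`-th members have the
same valleys at every height at most `h - j`.  (The function `σ` is frozen from
index `h` on, so that such multichains are counted correctly.) -/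
def IsVChain (a s : BinPath) (σ : ℕ → BinPath) : Prop :=
  σ 0 = a ∧ (∀ j, hvNat a ≤ j → σ j = s) ∧ (∀ j, IsDyck (σ j)) ∧
  (∀ j < hvNat a, pathLe (σ j) (σ (j + 1))) ∧
  (∀ j, 1 ≤ j → j ≤ hvNat a →
    sameValleysUpTo (σ (j - 1)) (σ j) ((hvNat a : ℤ) - (j : ℤ)))

/-- `V(a,s)`: the number of `a`–`s` multichains of type `V`. -/
noncomputable def VPath (a s : BinPath) : ℕ :=
  Set.ncard {σ : ℕ → BinPath | IsVChain a s σ}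

/-- `ζ^k(P,Q)`: the number of `P`–`Q` multichains of length `k`. -/
noncomputable def zetaPow (k : ℕ) (P Q : BinPath) : ℕ :=
  Set.ncard {c : ℕ → BinPath |
    c 0 = P ∧ (∀ i, k ≤ i → c i = Q) ∧ ∀ i < k, pathLe (c i) (c (i + 1))}

/-- The join of two paths of the same length (pointwise max of heights). -/
def pathSup (P Q : BinPath) : BinPath :=
  List.ofFn (fun i : Fin P.length =>
    decide (max (ht P i.1) (ht Q i.1) < max (ht P (i.1 + 1)) (ht Q (i.1 + 1))))

/-- The meet of two paths of the same length (pointwise min of heights). -/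
def pathInf (P Q : BinPath) : BinPath :=
  List.ofFn (fun i : Fin P.length =>
    decide (min (ht P i.1) (ht Q i.1) < min (ht P (i.1 + 1)) (ht Q (i.1 + 1))))

/-- `Q` covers `P` in the lattice of binary paths. -/
def pathCovBy (P Q : BinPath) : Prop :=
  pathLt P Q ∧ ∀ R : BinPath, pathLt P R → pathLt R Q → False

/-- `l(P,Q) = (1/2)·Σᵢ (hᵢ(Q) − hᵢ(P))`. -/
def lpq (P Q : BinPath) : ℕ :=
  ((∑ i ∈ Finset.range P.length, (ht Q (i + 1) - ht P (i + 1))) / 2).toNat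

/-- Convolution in the incidence algebra of the lattice of binary paths. -/
noncomputable def conv (F G : BinPath → BinPath → ℤ) : BinPath → BinPath → ℤ :=
  fun P Q => ∑ᶠ (R : BinPath) (_ : pathLe P R ∧ pathLe R Q), F P R * G R Q

/-- The delta function of the incidence algebra. -/
def deltaFun : BinPath → BinPath → ℤ := fun P Q => if P = Q then 1 else 0

/-- `μ^k`: the `k`-th convolution power of `μ` (`μ^0` is the delta function). -/
noncomputable def muPow (mu : BinPath → BinPath → ℤ) (k : ℕ) : BinPath → BinPath → ℤ :=
  (conv mu)^[k] deltaFun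

/-- The number of upsteps among the first `j` steps of `P`. -/
def ups (P : BinPath) (j : ℕ) : ℕ := (P.take j).count true

lemma ups_zero (P : BinPath) : ups P 0 = 0 := by simp [ups]

lemma ups_succ (P : BinPath) {j : ℕ} (hj : j < P.length) :
    ups P (j + 1) = ups P j + if P.getD j true = true then 1 else 0 := by
  unfold ups
  rw [List.take_add_one, List.count_append, List.getElem?_eq_getElem hj,
    List.getD_eq_getElem _ _ hj]
  cases P[j] <;> simp

lemma ups_of_length_le (P : BinPath) {j : ℕ} (hj : P.length ≤ j) :
    ups P j = ups P P.length := by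
  simp [ups, List.take_of_length_le hj]

lemma ups_append (P Q : BinPath) (j : ℕ) :
    ups (P ++ Q) j = ups P j + ups Q (j - P.length) := by
  simp [ups, List.take_append]

lemma ups_replicate_true (m j : ℕ) : ups (List.replicate m true) j = min j m := by
  simp [ups, List.take_replicate]

lemma ups_replicate_false (m j : ℕ) : ups (List.replicate m false) j = 0 := by
  simp [ups, List.take_replicate, List.count_replicate]

lemma ups_pyramid (m j : ℕ) : ups (pyramid m) j = min j m := by
  simp [pyramid, ups_append, ups_replicate_true, ups_replicate_false]

lemma length_pyramid (m : ℕ) : (pyramid m).length = 2 * m := by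
  simp [pyramid]; omega

lemma ht_eq_ups (P : BinPath) (j : ℕ) : ht P j = 2 * (ups P j : ℤ) - min j P.length := by
  have key : ∀ l : List Bool, (l.map (fun b => if b then (1 : ℤ) else -1)).sum
      = 2 * (l.count true : ℤ) - l.length := by
    intro l
    induction l with
    | nil => simp
    | cons b l ih =>
      rw [List.map_cons, List.sum_cons, ih]
      cases b <;> simp <;> ring
  rw [ht, key, List.length_take, ups]

lemma pathLe_iff (P Q : BinPath) :
    pathLe P Q ↔ P.length = Q.length ∧ ∀ j, ups P j ≤ ups Q j := by
  unfold pathLe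
  refine and_congr_right fun h => forall_congr' fun j => ?_
  rw [ht_eq_ups, ht_eq_ups, h]
  omega

/-- `u` is the upstep counting function of a binary path of length `n`. -/
structure IsUps (n : ℕ) (u : ℕ → ℕ) : Prop where
  zero : u 0 = 0
  mono : ∀ j, u j ≤ u (j + 1)
  step : ∀ j, u (j + 1) ≤ u j + 1
  const : ∀ j, n ≤ j → u j = u n

lemma IsUps.le {n : ℕ} {u : ℕ → ℕ} (h : IsUps n u) (j : ℕ) : u j ≤ j := by
  induction j with
  | zero => simp [h.zero]
  | succ j ih => have := h.step j; omega

lemma isUps_ups (P : BinPath) : IsUps P.length (ups P) := by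
  have key : ∀ j, ups P j ≤ ups P (j + 1) ∧ ups P (j + 1) ≤ ups P j + 1 := fun j => by
    rcases lt_or_ge j P.length with hj | hj
    · rw [ups_succ P hj]; split_ifs <;> omega
    · rw [ups_of_length_le P hj, ups_of_length_le P (by omega : P.length ≤ j + 1)]; omega
  exact ⟨ups_zero P, fun j => (key j).1, fun j => (key j).2, fun j => ups_of_length_le P⟩

lemma ups_injective {P Q : BinPath} (hl : P.length = Q.length) (h : ups P = ups Q) : P = Q := by
  refine List.ext_getElem hl fun i hi hi' => ?_
  have h₁ := ups_succ P hi
  have h₂ := ups_succ Q hi'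
  rw [h, h₂, List.getD_eq_getElem _ _ hi, List.getD_eq_getElem _ _ hi'] at h₁
  cases hP : P[i] <;> cases hQ : Q[i] <;> simp [hP, hQ] at h₁ ⊢

/-- The path of length `n` with upstep counting function `u`. -/
def toPath (n : ℕ) (u : ℕ → ℕ) : BinPath := List.ofFn fun i : Fin n => decide (u i < u (i + 1))

@[simp] lemma length_toPath (n : ℕ) (u : ℕ → ℕ) : (toPath n u).length = n := by simp [toPath]

lemma ups_toPath {n : ℕ} {u : ℕ → ℕ} (h : IsUps n u) : ups (toPath n u) = u := by
  have key : ∀ j ≤ n, ups (toPath n u) j = u j := by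
    intro j hj
    induction j with
    | zero => rw [ups_zero, h.zero]
    | succ j ih =>
      have hj' : j < (toPath n u).length := by simpa using hj
      rw [ups_succ _ hj', ih (by omega), List.getD_eq_getElem _ _ hj']
      have := h.mono j
      have := h.step j
      simp only [toPath, List.getElem_ofFn, decide_eq_true_eq]
      split_ifs <;> omega
  funext j
  rcases le_total j n with hj | hj
  · exact key j hj
  · rw [h.const j hj, ← key n le_rfl, ups_of_length_le _ (by simpa using hj), length_toPath]

@[simp] lemma length_fill (P : BinPath) : (fill P).length = P.length := by simp [fill]

lemma getD_fill (P : BinPath) {j : ℕ} (hj : j < P.length) :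
    (fill P).getD j true =
      if P.getD j true = true then P.getD (j - 1) true else P.getD (j + 1) true := by
  rw [List.getD_eq_getElem _ _ (by simpa using hj), List.getD_eq_getElem _ _ hj]
  simp [fill]

lemma ups_fill (P : BinPath) {j : ℕ} (hj : j < P.length) :
    ups (fill P) (j + 1) = ups P (j + 1) +
      if P.getD j true = false ∧ P.getD (j + 1) true = true then 1 else 0 := by
  induction j with
  | zero =>
    rw [ups_succ _ (by simpa using hj), ups_succ _ hj, getD_fill P hj, ups_zero, ups_zero]
    cases P.getD 0 true <;> simp
  | succ j ih =>
    rw [ups_succ _ (by simpa using hj), ih (by omega), getD_fill P hj, ups_succ P hj]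
    simp only [Nat.add_sub_cancel]
    cases P.getD j true <;> cases P.getD (j + 1) true <;> simp

lemma pathLe_fill_iff {P Q : BinPath} (hl : Q.length = P.length) :
    pathLe Q (fill P) ↔ ∀ j < P.length,
      ups Q j ≤ ups P (j + 1) ∧ ups Q (j + 1) ≤ ups P j + 1 := by
  rw [pathLe_iff, length_fill]
  constructor
  · rintro ⟨-, h⟩ j hj
    refine ⟨?_, ?_⟩
    · rcases j with _ | j
      · rw [ups_zero]; omega
      · refine (h _).trans ?_
        rw [ups_fill P (by omega), ups_succ P hj]
        split_ifs <;> simp_all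
    · refine (h _).trans ?_
      rw [ups_fill P hj, ups_succ P hj]
      split_ifs <;> simp_all
  · refine fun h => ⟨hl, ?_⟩
    have key : ∀ j ≤ P.length, ups Q j ≤ ups (fill P) j := by
      intro j hj
      rcases j with _ | j
      · rw [ups_zero]; omega
      · have h₁ := (h j hj).2
        rw [ups_fill P hj]
        rw [ups_succ P hj]
        rcases Nat.lt_or_ge (j + 1) P.length with hj' | hj'
        · have h₂ := (h (j + 1) hj').1
          rw [ups_succ P hj', ups_succ P hj] at h₂
          cases h₃ : P.getD j true <;> cases h₄ : P.getD (j + 1) true <;> simp_all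
        · rw [List.getD_eq_default _ _ hj']
          cases h₃ : P.getD j true <;> simp_all
    intro j
    rcases le_total j P.length with hj | hj
    · exact key j hj
    · rw [ups_of_length_le Q (hl ▸ hj), ups_of_length_le (fill P) (by simpa using hj),
        length_fill, hl]
      exact key _ le_rfl

/-- The (upstep counting functions of the) Dyck paths of length `n` of the form `u^k a d^k`
whose valleys in `a` are all at height `k`. -/
structure IsBase (n k : ℕ) (p : ℕ → ℕ) : Prop where
  isUps : IsUps n p
  nonneg : ∀ j ≤ n, j ≤ 2 * p j
  final : 2 * p n = n
  high : ∀ j ≤ n, p j = j ∨ n ≤ 2 * p j ∨ j + k ≤ 2 * p j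
  valley : ∀ j < n, p (j + 1) = p j + 1 ∨ (j + 1 < n ∧ p (j + 2) = p (j + 1)) ∨
    2 * p (j + 1) ≤ j + 1 + k

lemma IsBase.two_mul_le {n k : ℕ} {p : ℕ → ℕ} (h : IsBase n k p) (j : ℕ) : 2 * p j ≤ n := by
  have : p j ≤ p n := by
    rcases le_total j n with hj | hj
    · exact monotone_nat_of_le_succ h.isUps.mono hj
    · exact (h.isUps.const j hj).le
  have := h.final
  omega

/-- Every member of the sequence `U` of paths lies below the filling of the previous one. -/
structure IsSmall (n : ℕ) (U : ℕ → ℕ → ℕ) : Prop where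
  isUps : ∀ t, IsUps n (U t)
  right : ∀ t, ∀ j < n, U (t + 1) j ≤ U t (j + 1)
  left : ∀ t, ∀ j < n, U (t + 1) (j + 1) ≤ U t j + 1

lemma IsSmall.le_max {n : ℕ} {U : ℕ → ℕ → ℕ} (h : IsSmall n U)
    (h₀ : ∀ j, 2 * U 0 j ≤ n) (t : ℕ) : ∀ j ≤ n, 2 * U t j ≤ max (t + 1 + j) n := by
  induction t with
  | zero => intro j _; have := h₀ j; omega
  | succ t ih =>
    intro j hj
    rcases Nat.lt_or_ge j n with hj' | hj'
    · have := h.right t j hj'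
      have := ih (j + 1) hj'
      omega
    · rcases j with _ | j
      · rw [(h.isUps _).zero]; omega
      · have := h.left t j hj
        have := ih j (by omega)
        omega

lemma IsSmall.length_le {n : ℕ} {U : ℕ → ℕ → ℕ} (h : IsSmall n U)
    (h₀ : ∀ j, 2 * U 0 j ≤ n) {m : ℕ} (hm : U m n = n) : n ≤ m + 1 := by
  have := h.le_max h₀ m n le_rfl
  omega

/-- The sequences of length `n - 1` with small intervals from `p` to the maximum path. -/
structure IsSmallChain (n : ℕ) (p : ℕ → ℕ) (U : ℕ → ℕ → ℕ) : Prop extends IsSmall n U where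
  start : U 0 = p
  mono : ∀ t j, U t j ≤ U (t + 1) j
  top : ∀ t, n ≤ t + 1 → ∀ j ≤ n, U t j = j

/-- The multichains of length `k` starting at `p` and bounded by the pyramid, extended by the
maximum path. -/
structure IsPyrChain (n k : ℕ) (p : ℕ → ℕ) (E : ℕ → ℕ → ℕ) : Prop where
  isUps : ∀ s, IsUps n (E s)
  start : E 0 = p
  mono : ∀ s j, E s j ≤ E (s + 1) j
  le_pyr : ∀ s ≤ k, ∀ j, 2 * E s j ≤ n
  top : ∀ s, k < s → ∀ j ≤ n, E s j = j

namespace IsSmallChain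

variable {n k : ℕ} {p : ℕ → ℕ} {U : ℕ → ℕ → ℕ}

lemma monotone (h : IsSmallChain n p U) {s t : ℕ} (hst : s ≤ t) (j : ℕ) : U s j ≤ U t j :=
  monotone_nat_of_le_succ (f := fun t => U t j) (fun t => h.mono t j) hst

lemma min_le (h : IsSmallChain n p U) {t : ℕ} (ht : t + 1 ≤ n) :
    ∀ j ≤ n, min t j + j ≤ 2 * U t j := by
  have key : ∀ r t, t + r + 1 = n → ∀ j ≤ n, min t j + j ≤ 2 * U t j := by
    intro r
    induction r with
    | zero => intro t ht j hj; rw [h.top t (by omega) j hj]; omega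
    | succ r ih =>
      intro t ht j hj
      rcases Nat.lt_or_ge j n with hj' | hj'
      · rcases j with _ | j
        · omega
        have := h.right t _ hj'
        have := h.left t _ hj'
        have := ih (t + 1) (by omega) (j + 1 + 1) hj'
        omega
      · rcases j with _ | j
        · omega
        have := h.right t j hj
        have := ih (t + 1) (by omega) j (by omega)
        omega
  exact key (n - 1 - t) t (by omega)

lemma le_max_base (hp : IsBase n k p) (h : IsSmallChain n p U) (t : ℕ) :
    ∀ j ≤ n, 2 * U t j ≤ max (t + 1 + k + j) (2 * p j) := by
  induction t with
  | zero => intro j _; rw [h.start]; omega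
  | succ t ih =>
    intro j hj
    rcases j with _ | j
    · rw [(h.isUps _).zero]; omega
    have h₁ := h.left t j hj
    have h₂ := ih j (by omega)
    have h₃ := hp.isUps.step j
    rcases hp.valley j hj with h₄ | ⟨h₄, h₅⟩ | h₄
    · omega
    · have : U (t + 1) (j + 1) ≤ U t (j + 2) := h.right t (j + 1) h₄
      have := ih (j + 2) h₄
      omega
    · have := hp.isUps.mono j
      omega

lemma add_two_le (h : IsSmallChain n p U) (t : ℕ) {j : ℕ} (hj : j ≤ n) :
    U (t + 2) j ≤ U t j + 1 := by
  rcases Nat.lt_or_ge j n with hj' | hj'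
  · have : U (t + 2) j ≤ U (t + 1) (j + 1) := h.right (t + 1) j hj'
    have := h.left t j hj'
    omega
  · rcases j with _ | j
    · rw [(h.isUps _).zero]; omega
    · have : U (t + 2) (j + 1) ≤ U (t + 1) j + 1 := h.left (t + 1) j hj
      have := h.right t j hj
      omega

end IsSmallChain

/-- The length of the initial segment of `ℕ` on which `q` holds. -/
noncomputable def initLen (q : ℕ → Prop) : ℕ := sInf {x | ¬ q x}

lemma lt_initLen {q : ℕ → Prop} (hq : ∀ x, q (x + 1) → q x) {b : ℕ} (hb : ¬ q b) {x : ℕ} :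
    x < initLen q ↔ q x := by
  have hmem : ¬ q (initLen q) := Nat.sInf_mem (s := {x | ¬ q x}) ⟨b, hb⟩
  constructor
  · intro hx
    by_contra hn
    exact absurd (Nat.sInf_le (s := {x | ¬ q x}) hn) (by unfold initLen at hx; omega)
  · intro hx
    by_contra! hn
    exact hmem (antitone_nat_of_succ_le (f := q) hq hn hx)

/-- The cells of the `s`-th path of the multichain are those filled in `U` with the delay
prescribed by their height. -/
noncomputable def toPyr (n k : ℕ) (U : ℕ → ℕ → ℕ) (s j : ℕ) : ℕ :=
  initLen fun x => x < U (s + 2 * x - min j n - k) (min j n)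

/-- The inverse of `toPyr`. -/
noncomputable def toSmall (n k : ℕ) (E : ℕ → ℕ → ℕ) (t j : ℕ) : ℕ :=
  initLen fun x => x < E (t + k + min j n - 2 * x) (min j n)

section Bijection

variable {n k : ℕ} {p : ℕ → ℕ} {U E : ℕ → ℕ → ℕ}

lemma lt_toPyr (h : IsSmallChain n p U) {s j x : ℕ} (hj : j ≤ n) :
    x < toPyr n k U s j ↔ x < U (s + 2 * x - j - k) j := by
  unfold toPyr
  rw [min_eq_left hj]
  refine lt_initLen (q := fun x => x < U (s + 2 * x - j - k) j) (fun x hx => ?_) (b := j) ?_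
  · have h₁ := h.add_two_le (s + 2 * x - j - k) hj
    have h₂ := h.monotone (s := s + 2 * (x + 1) - j - k) (t := s + 2 * x - j - k + 2)
      (by omega) j
    omega
  · have := (h.isUps (s + 2 * j - j - k)).le j
    omega

lemma IsPyrChain.monotone (h : IsPyrChain n k p E) {s t : ℕ} (hst : s ≤ t) (j : ℕ) :
    E s j ≤ E t j :=
  monotone_nat_of_le_succ (f := fun t => E t j) (fun t => h.mono t j) hst

lemma lt_toSmall (h : IsPyrChain n k p E) {t j x : ℕ} (hj : j ≤ n) :
    x < toSmall n k E t j ↔ x < E (t + k + j - 2 * x) j := by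
  unfold toSmall
  rw [min_eq_left hj]
  refine lt_initLen (q := fun x => x < E (t + k + j - 2 * x) j) (fun x hx => ?_) (b := j) ?_
  · have := h.monotone (s := t + k + j - 2 * (x + 1)) (t := t + k + j - 2 * x) (by omega) j
    omega
  · have := (h.isUps (t + k + j - 2 * j)).le j
    omega

lemma toPyr_of_le {s j : ℕ} (hj : n ≤ j) : toPyr n k U s j = toPyr n k U s n := by
  simp [toPyr, min_eq_right hj]

lemma toSmall_of_le {t j : ℕ} (hj : n ≤ j) : toSmall n k E t j = toSmall n k E t n := by
  simp [toSmall, min_eq_right hj]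

lemma isUps_of_forall_lt {u : ℕ → ℕ} (h₀ : u 0 = 0)
    (h₁ : ∀ j < n, ∀ x, x < u j → x < u (j + 1))
    (h₂ : ∀ j < n, ∀ x, x + 1 < u (j + 1) → x < u j) (h₃ : ∀ j, n ≤ j → u j = u n) :
    IsUps n u := by
  refine ⟨h₀, fun j => ?_, fun j => ?_, h₃⟩
  · rcases Nat.lt_or_ge j n with hj | hj
    · exact le_of_forall_lt (h₁ j hj)
    · rw [h₃ j hj, h₃ (j + 1) (by omega)]
  · rcases Nat.lt_or_ge j n with hj | hj
    · by_contra! hn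
      exact lt_irrefl _ (h₂ j hj _ hn)
    · rw [h₃ j hj, h₃ (j + 1) (by omega)]; omega

lemma toPyr_zero (hp : IsBase n k p) (h : IsSmallChain n p U) : toPyr n k U 0 = p := by
  have key : ∀ j ≤ n, toPyr n k U 0 j = p j := by
    intro j hj
    refine eq_of_forall_lt_iff fun x => ?_
    rw [lt_toPyr h hj]
    constructor
    · intro hx
      by_contra! hn
      have := h.le_max_base hp (0 + 2 * x - j - k) j hj
      have h₂ : 2 * x - j - k = 0 ∨ 0 < 2 * x - j - k := by omega
      rcases h₂ with h₂ | h₂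
      · rw [zero_add, h₂, h.start] at hx; omega
      · omega
    · intro hx
      have := h.monotone (Nat.zero_le (0 + 2 * x - j - k)) j
      rw [h.start] at this
      omega
  funext j
  rcases le_total j n with hj | hj
  · exact key j hj
  · rw [toPyr_of_le hj, key n le_rfl, hp.isUps.const j hj]

lemma toSmall_zero (hp : IsBase n k p) (h : IsPyrChain n k p E) : toSmall n k E 0 = p := by
  have key : ∀ j ≤ n, toSmall n k E 0 j = p j := by
    intro j hj
    refine eq_of_forall_lt_iff fun x => ?_
    rw [lt_toSmall h hj]
    constructor
    · intro hx
      by_contra! hn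
      have h₁ := (h.isUps (0 + k + j - 2 * x)).le j
      have h₂ := hp.nonneg j hj
      have h₃ := h.le_pyr (0 + k + j - 2 * x) (by omega) j
      rcases hp.high j hj with h₄ | h₄ | h₄
      · omega
      · omega
      · rw [show 0 + k + j - 2 * x = 0 by omega, h.start] at hx
        omega
    · intro hx
      have := h.monotone (Nat.zero_le (0 + k + j - 2 * x)) j
      rw [h.start] at this
      omega
  funext j
  rcases le_total j n with hj | hj
  · exact key j hj
  · rw [toSmall_of_le hj, key n le_rfl, hp.isUps.const j hj]

lemma isPyrChain_toPyr (hp : IsBase n k p) (h : IsSmallChain n p U) :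
    IsPyrChain n k p (toPyr n k U) := by
  have hpath : ∀ s, IsUps n (toPyr n k U s) := by
    intro s
    refine isUps_of_forall_lt ?_ (fun j hj x => ?_) (fun j hj x => ?_) (fun j => toPyr_of_le)
    · rw [← Nat.le_zero, ← not_lt, lt_toPyr h (Nat.zero_le n), (h.isUps _).zero]
      exact lt_irrefl _
    · rw [lt_toPyr h hj.le, lt_toPyr h hj]
      intro hx
      rcases Nat.eq_zero_or_pos (s + 2 * x - j - k) with h₀ | h₀
      · rw [h₀] at hx
        rw [show s + 2 * x - (j + 1) - k = 0 by omega]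
        exact hx.trans_le ((h.isUps 0).mono j)
      · refine hx.trans_le ?_
        have := h.right (s + 2 * x - (j + 1) - k) j hj
        rwa [show s + 2 * x - (j + 1) - k + 1 = s + 2 * x - j - k by omega] at this
    · rw [lt_toPyr h hj.le, lt_toPyr h (j := j + 1) hj]
      intro hx
      have h₁ := h.left (s + 2 * x - j - k) j hj
      have h₂ := h.monotone (s := s + 2 * (x + 1) - (j + 1) - k)
        (t := s + 2 * x - j - k + 1) (by omega) (j + 1)
      omega
  refine ⟨hpath, toPyr_zero hp h, fun s j => ?_, fun s hs j => ?_, fun s hs j hj => ?_⟩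
  · rcases le_total j n with hj | hj
    · refine le_of_forall_lt fun x => ?_
      rw [lt_toPyr h hj, lt_toPyr h hj]
      exact fun hx => hx.trans_le (h.monotone (by omega) j)
    · rw [toPyr_of_le hj, toPyr_of_le hj]
      refine le_of_forall_lt fun x => ?_
      rw [lt_toPyr h le_rfl, lt_toPyr h le_rfl]
      exact fun hx => hx.trans_le (h.monotone (by omega) n)
  · have key : ∀ j ≤ n, 2 * toPyr n k U s j ≤ n := by
      intro j hj
      have hn := hp.final
      by_contra! hlt
      have hx : p n < toPyr n k U s j := by omega
      rw [lt_toPyr h hj] at hx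
      have := h.le_max (fun j => by rw [h.start]; exact hp.two_mul_le j)
        (s + 2 * p n - j - k) j hj
      omega
    rcases le_total j n with hj | hj
    · exact key j hj
    · rw [toPyr_of_le hj]; exact key n le_rfl
  · refine le_antisymm ((hpath s).le j) (le_of_forall_lt fun x hx => ?_)
    rw [lt_toPyr h hj]
    rcases Nat.lt_or_ge (s + 2 * x - j - k + 1) n with hlt | hge
    · have h₁ := h.min_le (t := s + 2 * x - j - k) (by omega) j hj
      omega
    · rw [h.top _ hge j hj]; exact hx

lemma isSmallChain_toSmall (hp : IsBase n k p) (h : IsPyrChain n k p E) :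
    IsSmallChain n p (toSmall n k E) := by
  have hleft : ∀ t t', t ≤ t' + 1 → ∀ j < n,
      toSmall n k E t (j + 1) ≤ toSmall n k E t' j + 1 := by
    intro t t' ht j hj
    by_contra! hn
    rw [lt_toSmall h (j := j + 1) hj] at hn
    refine lt_irrefl (toSmall n k E t' j) ?_
    nth_rw 1 [lt_toSmall h hj.le]
    set x := toSmall n k E t' j
    have h₁ := (h.isUps (t + k + (j + 1) - 2 * (x + 1))).step j
    have h₂ := h.monotone (s := t + k + (j + 1) - 2 * (x + 1)) (t := t' + k + j - 2 * x)
      (by omega) j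
    omega
  have hright : ∀ t t', t ≤ t' + 1 → ∀ j < n,
      toSmall n k E t j ≤ toSmall n k E t' (j + 1) := by
    intro t t' ht j hj
    refine le_of_forall_lt fun x => ?_
    rw [lt_toSmall h hj.le, lt_toSmall h (j := j + 1) hj]
    intro hx
    have h₁ := (h.isUps (t + k + j - 2 * x)).mono j
    have h₂ := h.monotone (s := t + k + j - 2 * x) (t := t' + k + (j + 1) - 2 * x)
      (by omega) (j + 1)
    omega
  have hmono : ∀ t, ∀ j ≤ n, toSmall n k E t j ≤ toSmall n k E (t + 1) j := by
    intro t j hj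
    refine le_of_forall_lt fun x => ?_
    rw [lt_toSmall h hj, lt_toSmall h hj]
    exact fun hx => hx.trans_le (h.monotone (by omega) j)
  have hpath : ∀ t, IsUps n (toSmall n k E t) := by
    intro t
    refine isUps_of_forall_lt ?_ (fun j hj x hx => hx.trans_le (hright t t (by omega) j hj))
      (fun j hj x hx => ?_) (fun j => toSmall_of_le)
    · rw [← Nat.le_zero, ← not_lt, lt_toSmall h (Nat.zero_le n), (h.isUps _).zero]
      exact lt_irrefl _
    · have := hleft t t (by omega) j hj
      omega
  refine ⟨⟨hpath, fun t => hright _ _ le_rfl, fun t => hleft _ _ le_rfl⟩, toSmall_zero hp h,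
    fun t j => ?_, fun t ht j hj => ?_⟩
  · rcases le_total j n with hj | hj
    · exact hmono t j hj
    · rw [toSmall_of_le hj, toSmall_of_le hj]
      exact hmono t n le_rfl
  · refine le_antisymm ((hpath t).le j) (le_of_forall_lt fun x hx => ?_)
    rw [lt_toSmall h hj, h.top _ (by omega) j hj]
    exact hx

lemma IsUps.eq_of_lt_iff {u v : ℕ → ℕ} (hu : IsUps n u) (hv : IsUps n v)
    (h : ∀ j ≤ n, ∀ x, x < u j ↔ x < v j) : u = v := by
  funext j
  rcases le_total j n with hj | hj
  · exact eq_of_forall_lt_iff (h j hj)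
  · rw [hu.const j hj, hv.const j hj]
    exact eq_of_forall_lt_iff (h n le_rfl)

lemma toSmall_toPyr (hp : IsBase n k p) (h : IsSmallChain n p U) :
    toSmall n k (toPyr n k U) = U := by
  have hE := isPyrChain_toPyr hp h
  funext t
  refine IsUps.eq_of_lt_iff ((isSmallChain_toSmall hp hE).isUps t) (h.isUps t) fun j hj x => ?_
  rw [lt_toSmall hE hj]
  rcases le_total (2 * x) (t + k + j) with hx | hx
  · rw [lt_toPyr h hj, show t + k + j - 2 * x + 2 * x - j - k = t by omega]
  · rw [show t + k + j - 2 * x = 0 by omega, toPyr_zero hp h]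
    have h₁ := h.le_max_base hp t j hj
    have h₂ := h.monotone (Nat.zero_le t) j
    rw [h.start] at h₂
    omega

lemma toPyr_toSmall (hp : IsBase n k p) (h : IsPyrChain n k p E) :
    toPyr n k (toSmall n k E) = E := by
  have hU := isSmallChain_toSmall hp h
  funext s
  refine IsUps.eq_of_lt_iff ((isPyrChain_toPyr hp hU).isUps s) (h.isUps s) fun j hj x => ?_
  rw [lt_toPyr hU hj]
  rcases le_total (j + k) (s + 2 * x) with hx | hx
  · rw [lt_toSmall h hj, show s + 2 * x - j - k + k + j - 2 * x = s by omega]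
  · have h₀ := toSmall_zero hp h
    rw [show s + 2 * x - j - k = 0 by omega]
    constructor
    · intro hlt
      rw [h₀, ← h.start] at hlt
      exact hlt.trans_le (h.monotone (Nat.zero_le s) j)
    · intro hlt
      rw [lt_toSmall h hj]
      exact hlt.trans_le (h.monotone (by omega) j)

lemma ncard_isSmallChain (hp : IsBase n k p) :
    {U | IsSmallChain n p U}.ncard = {E | IsPyrChain n k p E}.ncard :=
  Set.ncard_congr (fun U _ => toPyr n k U) (fun _ hU => isPyrChain_toPyr hp hU)
    (fun U V hU hV hUV => by rw [← toSmall_toPyr hp hU, hUV, toSmall_toPyr hp hV])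
    (fun E hE => ⟨_, isSmallChain_toSmall hp hE, toPyr_toSmall hp hE⟩)

end Bijection

lemma eq_maxPath_iff {P : BinPath} {n : ℕ} (hl : P.length = n) :
    P = maxPath n ↔ ∀ j ≤ n, ups P j = j := by
  constructor
  · rintro rfl j hj
    rw [maxPath, ups_replicate_true, min_eq_left hj]
  · intro h
    refine ups_injective (by simp [hl, maxPath]) (funext fun j => ?_)
    rw [maxPath, ups_replicate_true]
    rcases le_total j n with hj | hj
    · rw [h j hj, min_eq_left hj]
    · rw [ups_of_length_le P (hl ▸ hj), hl, h n le_rfl, min_eq_right hj]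

lemma pathLe_refl (P : BinPath) : pathLe P P := ⟨rfl, fun _ => le_rfl⟩

lemma length_iterate_fill (P : BinPath) (t : ℕ) : (fill^[t] P).length = P.length := by
  induction t with
  | zero => rfl
  | succ t ih => rw [Function.iterate_succ_apply', length_fill, ih]

lemma isSmall_of_pathLe_fill {n : ℕ} {c : ℕ → BinPath} (hl : ∀ t, (c t).length = n)
    (h : ∀ t, pathLe (c (t + 1)) (fill (c t))) : IsSmall n fun t => ups (c t) := by
  have key t := (pathLe_fill_iff (by rw [hl, hl])).1 (h t)
  refine ⟨fun t => hl t ▸ isUps_ups (c t), fun t j hj => ?_, fun t j hj => ?_⟩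
  · exact (key t j (by rwa [hl])).1
  · exact (key t j (by rwa [hl])).2

lemma iterate_fill_eq_maxPath {P : BinPath} (h : ∀ j ≤ P.length, j ≤ 2 * ups P j) :
    fill^[P.length - 1] P = maxPath P.length := by
  have key : ∀ t, ∀ j ≤ P.length, min t j + j ≤ 2 * ups (fill^[t] P) j := by
    intro t
    induction t with
    | zero => intro j hj; simpa using h j hj
    | succ t ih =>
      intro j hj
      rcases j with _ | j
      · omega
      have hlen := length_iterate_fill P t
      have hj' : j < (fill^[t] P).length := by omega
      have h₁ := ih j (by omega)
      have h₂ := ih (j + 1) hj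
      have h₅ := ups_succ _ hj'
      rw [Function.iterate_succ_apply', ups_fill _ hj']
      rcases Nat.lt_or_ge (j + 1) P.length with h₄ | h₄
      · have h₃ := ih (j + 1 + 1) h₄
        have h₆ := ups_succ (fill^[t] P) (j := j + 1) (by omega)
        generalize (fill^[t] P).getD j true = b at h₅ ⊢
        generalize (fill^[t] P).getD (j + 1) true = b' at h₆ ⊢
        cases b <;> cases b' <;> simp at h₅ h₆ ⊢ <;> omega
      · rw [List.getD_eq_default (n := j + 1) _ _ (by omega)]
        generalize (fill^[t] P).getD j true = b at h₅ ⊢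
        cases b <;> simp at h₅ ⊢ <;> omega
  rw [eq_maxPath_iff (length_iterate_fill P _)]
  intro j hj
  have h₁ := key (P.length - 1) j hj
  have h₂ := (isUps_ups (fill^[P.length - 1] P)).le j
  omega

lemma degree_eq {P : BinPath} (h : ∀ j ≤ P.length, j ≤ 2 * ups P j)
    (h' : ∀ j, 2 * ups P j ≤ P.length) : degree P = P.length - 1 := by
  refine le_antisymm (Nat.sInf_le (iterate_fill_eq_maxPath h))
    (le_csInf ⟨_, iterate_fill_eq_maxPath h⟩ fun m hm => ?_)
  have hs : IsSmall P.length fun t => ups (fill^[t] P) :=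
    isSmall_of_pathLe_fill (length_iterate_fill P) fun t => by
      rw [Function.iterate_succ_apply']; exact pathLe_refl _
  have := hs.length_le h' ((eq_maxPath_iff (length_iterate_fill P m)).1 hm _ le_rfl)
  omega

/-- A sequence with small intervals from a Dyck path to the maximum path in the minimal number
of steps has no repetition. -/
lemma ne_succ_of_small {n : ℕ} {c : ℕ → BinPath} (hl : ∀ t, (c t).length = n)
    (h : ∀ t, pathLe (c (t + 1)) (fill (c t))) (h₀ : ∀ j, 2 * ups (c 0) j ≤ n)
    (htop : c (n - 1) = maxPath n) {i : ℕ} (hi : i < n - 1) : c i ≠ c (i + 1) := by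
  intro heq
  set e : ℕ → BinPath := fun t => if t ≤ i then c t else c (t + 1) with he
  have hel : ∀ t, (e t).length = n := fun t => by
    simp only [he]; split_ifs <;> exact hl _
  have hs : IsSmall n fun t => ups (e t) := isSmall_of_pathLe_fill hel fun t => by
    simp only [he]
    rcases lt_trichotomy t i with ht | ht | ht
    · rw [if_pos (by omega), if_pos (by omega)]; exact h t
    · subst ht
      rw [if_neg (by omega), if_pos le_rfl, heq]; exact h (t + 1)
    · rw [if_neg (by omega), if_neg (by omega)]; exact h (t + 1)
  have hend : e (n - 2) = maxPath n := by
    simp only [he]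
    split_ifs with hle
    · rw [show n - 2 = i by omega, heq, show i + 1 = n - 1 by omega, htop]
    · rw [show n - 2 + 1 = n - 1 by omega, htop]
  have := hs.length_le (by simpa [he] using h₀) (m := n - 2)
    ((eq_maxPath_iff (hel _)).1 hend n le_rfl)
  omega

lemma fPath_eq_ncard {P : BinPath} {n k : ℕ} (hn : P.length = n) (hp : IsBase n k (ups P)) :
    fPath P = {U | IsSmallChain n (ups P) U}.ncard := by
  subst hn
  set n := P.length
  have hdeg : degree P = n - 1 := degree_eq hp.nonneg hp.two_mul_le
  have hlen : ∀ c : ℕ → BinPath, c 0 = P → (∀ i, n - 1 ≤ i → c i = maxPath n) →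
      (∀ i < n - 1, pathLe (c i) (c (i + 1))) → ∀ t, (c t).length = n := by
    intro c h₀ h₁ h₂ t
    induction t with
    | zero => rw [h₀]
    | succ t ih =>
      rcases Nat.lt_or_ge t (n - 1) with ht | ht
      · rw [← (h₂ t ht).1, ih]
      · rw [h₁ (t + 1) (by omega), maxPath, List.length_replicate]
  have hmaxlen : (maxPath n).length = n := List.length_replicate
  have hmax : pathLe (maxPath n) (fill (maxPath n)) := by
    rw [pathLe_fill_iff rfl, hmaxlen]
    intro j hj
    simp only [maxPath, ups_replicate_true]
    omega
  unfold fPath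
  rw [hdeg]
  refine Set.ncard_congr (fun c _ t => ups (c t)) ?_ ?_ ?_
  · rintro c ⟨h₀, h₁, h₂⟩
    have hl := hlen c h₀ h₁ fun i hi => (h₂ i hi).1.1
    refine ⟨isSmall_of_pathLe_fill hl fun t => ?_, by rw [h₀], fun t j => ?_, fun t ht => ?_⟩
    · rcases Nat.lt_or_ge t (n - 1) with ht | ht
      · exact (h₂ t ht).2
      · rw [h₁ t ht, h₁ (t + 1) (by omega)]; exact hmax
    · rcases Nat.lt_or_ge t (n - 1) with ht | ht
      · exact ((pathLe_iff _ _).1 (h₂ t ht).1.1).2 j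
      · rw [h₁ t ht, h₁ (t + 1) (by omega)]
    · exact (eq_maxPath_iff (hl t)).1 (h₁ t (by omega))
  · rintro c d ⟨hc₀, hc₁, hc₂⟩ ⟨hd₀, hd₁, hd₂⟩ heq
    have hlc := hlen c hc₀ hc₁ fun i hi => (hc₂ i hi).1.1
    have hld := hlen d hd₀ hd₁ fun i hi => (hd₂ i hi).1.1
    exact funext fun t => ups_injective (by rw [hlc, hld]) (congrFun heq t)
  · intro U hU
    have hups t : ups (toPath n (U t)) = U t := ups_toPath (hU.isUps t)
    have htop : ∀ t, n - 1 ≤ t → toPath n (U t) = maxPath n := fun t ht => by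
      rw [eq_maxPath_iff (length_toPath _ _), hups]
      exact hU.top t (by omega)
    have hfill : ∀ t, pathLe (toPath n (U (t + 1))) (fill (toPath n (U t))) := fun t => by
      rw [pathLe_fill_iff (by simp), length_toPath, hups, hups]
      exact fun j hj => ⟨hU.right t j hj, hU.left t j hj⟩
    refine ⟨fun t => toPath n (U t), ⟨?_, htop, fun t ht => ⟨⟨?_, ?_⟩, hfill t⟩⟩,
      funext hups⟩
    · exact ups_injective (length_toPath _ _) (by rw [hups, hU.start])
    · rw [pathLe_iff, length_toPath, length_toPath, hups, hups]
      exact ⟨rfl, hU.mono t⟩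
    · refine ne_succ_of_small (fun t => length_toPath _ _) hfill (fun j => ?_)
        (htop _ le_rfl) ht
      rw [hups, hU.start]
      exact hp.two_mul_le j

/-- The height profile of products of pyramids: Dyck paths with all valleys at height `0`. -/
structure IsPyramidProduct (a : BinPath) : Prop where
  nonneg : ∀ j ≤ a.length, j ≤ 2 * ups a j
  final : 2 * ups a a.length = a.length
  valley : ∀ j, j + 1 < a.length → ups a (j + 1) = ups a j + 1 ∨ ups a (j + 2) = ups a (j + 1) ∨
    2 * ups a (j + 1) ≤ j + 1

lemma isPyramidProduct_flatten (L : List ℕ) : IsPyramidProduct (L.map pyramid).flatten := by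
  induction L with
  | nil => exact ⟨by simp, by simp [ups], by simp⟩
  | cons m L ih =>
    rw [List.map_cons, List.flatten_cons]
    obtain ⟨h₁, h₂, h₃⟩ := ih
    set a := (L.map pyramid).flatten
    have hu : ∀ j, ups (pyramid m ++ a) j = min j m + ups a (j - 2 * m) := fun j => by
      rw [ups_append, ups_pyramid, length_pyramid]
    have hl : (pyramid m ++ a).length = 2 * m + a.length := by
      rw [List.length_append, length_pyramid]
    have h₀ := ups_zero a
    refine ⟨fun j hj => ?_, ?_, fun j hj => ?_⟩
    · rw [hu]
      rcases le_total j (2 * m) with h | h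
      · rw [Nat.sub_eq_zero_of_le h]; omega
      · have := h₁ (j - 2 * m) (by omega)
        omega
    · rw [hu, hl, Nat.add_sub_cancel_left]
      omega
    · rw [hu, hu, hu]
      rcases lt_trichotomy (j + 1) (2 * m) with h | h | h
      · rw [Nat.sub_eq_zero_of_le (by omega : j + 1 ≤ 2 * m),
          Nat.sub_eq_zero_of_le (by omega : j ≤ 2 * m),
          Nat.sub_eq_zero_of_le (by omega : j + 2 ≤ 2 * m)]
        omega
      · rw [h, Nat.sub_self]
        omega
      · have := h₃ (j - 2 * m) (by omega)
        rw [show j + 1 - 2 * m = j - 2 * m + 1 by omega,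
          show j + 2 - 2 * m = j - 2 * m + 2 by omega]
        omega

lemma length_wrap (k : ℕ) (a : BinPath) :
    (List.replicate k true ++ a ++ List.replicate k false).length = a.length + 2 * k := by
  simp; omega

lemma ups_wrap (k : ℕ) (a : BinPath) (j : ℕ) :
    ups (List.replicate k true ++ a ++ List.replicate k false) j =
      min j k + ups a (j - k) := by
  simp [ups_append, ups_replicate_true, ups_replicate_false]

lemma IsPyramidProduct.isBase {a : BinPath} (h : IsPyramidProduct a) (k : ℕ) :
    IsBase (a.length + 2 * k) k
      (ups (List.replicate k true ++ a ++ List.replicate k false)) := by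
  obtain ⟨h₁, h₂, h₃⟩ := h
  have hc : ∀ j, a.length ≤ j → ups a j = ups a a.length := fun j => ups_of_length_le a
  have h₀ := ups_zero a
  refine ⟨length_wrap k a ▸ isUps_ups _, fun j hj => ?_, ?_, fun j hj => ?_, fun j hj => ?_⟩
  · rw [ups_wrap]
    rcases le_total (j - k) a.length with h | h
    · have := h₁ _ h; omega
    · have := hc _ h; omega
  · rw [ups_wrap, hc _ (by omega)]
    omega
  · rw [ups_wrap]
    rcases le_total (j - k) a.length with h | h
    · have := h₁ _ h
      rcases le_total j k with h' | h'
      · rw [Nat.sub_eq_zero_of_le h']; omega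
      · omega
    · have := hc _ h; omega
  · rw [ups_wrap, ups_wrap, ups_wrap]
    rcases Nat.lt_or_ge j k with hjk | hjk
    · rw [Nat.sub_eq_zero_of_le (by omega : j + 1 ≤ k), Nat.sub_eq_zero_of_le hjk.le]
      omega
    · rw [show j + 1 - k = j - k + 1 by omega, show j + 2 - k = j - k + 2 by omega]
      rcases lt_trichotomy (j - k + 1) a.length with h | h | h
      · have := h₃ _ h; omega
      · rw [h]; omega
      · rw [hc _ h.le, hc _ (by omega : a.length ≤ j - k + 2)]
        omega

lemma zetaPow_eq_ncard {a : BinPath} (ha : IsPyramidProduct a) (k : ℕ) :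
    zetaPow (k + 1) a (pyramid (a.length / 2)) =
      {E | IsPyrChain (a.length + 2 * k) k
        (ups (List.replicate k true ++ a ++ List.replicate k false)) E}.ncard := by
  let wrap : BinPath → BinPath :=
    fun b => List.replicate k true ++ b ++ List.replicate k false
  set m := a.length
  have hm2 : 2 * (m / 2) = m := by have := ha.final; omega
  have hlen : ∀ c : ℕ → BinPath, c 0 = a → (∀ i < k + 1, pathLe (c i) (c (i + 1))) →
      ∀ s ≤ k + 1, (c s).length = m := by
    intro c h₀ h₁ s hs
    induction s with
    | zero => rw [h₀]
    | succ s ih => rw [← (h₁ s (by omega)).1, ih (by omega)]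
  have hups_wrap : ∀ b j, ups (wrap b) j = min j k + ups b (j - k) := ups_wrap k
  have hwlen : ∀ b, (wrap b).length = b.length + 2 * k := length_wrap k
  unfold zetaPow
  refine Set.ncard_congr
    (fun c _ s => if s ≤ k then ups (wrap (c s)) else fun j => min j (m + 2 * k)) ?_ ?_ ?_
  · rintro c ⟨h₀, h₁, h₂⟩
    have hl := hlen c h₀ h₂
    have hle : ∀ s ≤ k, ∀ j, ups (c s) j ≤ ups (c (s + 1)) j := fun s hs =>
      ((pathLe_iff _ _).1 (h₂ s (by omega))).2
    have hpyr : ∀ s ≤ k, ∀ j, ups (c s) j ≤ min j (m / 2) := by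
      intro s hs j
      rw [← ups_pyramid, ← h₁ (k + 1) le_rfl]
      induction hs using Nat.decreasingInduction with
      | self => exact hle k le_rfl j
      | of_succ s hs ih => exact (hle s (by omega) j).trans ih
    have hbound : ∀ s ≤ k, ∀ j, 2 * ups (wrap (c s)) j ≤ m + 2 * k := by
      intro s hs j
      have := hpyr s hs (j - k)
      rw [hups_wrap]; omega
    refine ⟨fun s => ?_, ?_, fun s j => ?_, fun s hs j => ?_, fun s hs j hj => ?_⟩
    · split_ifs with hs
      · have := isUps_ups (wrap (c s))
        rwa [hwlen, hl s (by omega)] at this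
      · exact ⟨by simp, by omega, by omega, by omega⟩
    · rw [if_pos (Nat.zero_le k), h₀]
    · split_ifs with hs hs' hs'
      · rw [hups_wrap, hups_wrap]
        have := hle s hs (j - k)
        omega
      · have h₃ := hbound s hs j
        have h₄ := (isUps_ups (wrap (c s))).le j
        dsimp only
        omega
      · omega
      · exact le_rfl
    · simp only [if_pos hs]
      exact hbound s hs j
    · simp only [if_neg (not_le.2 hs)]
      omega
  · rintro c d ⟨hc₀, hc₁, hc₂⟩ ⟨hd₀, hd₁, hd₂⟩ heq
    funext s
    rcases Nat.lt_or_ge k s with hs | hs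
    · rw [hc₁ s hs, hd₁ s hs]
    · refine ups_injective ?_ (funext fun j => ?_)
      · rw [hlen c hc₀ hc₂ s (by omega), hlen d hd₀ hd₂ s (by omega)]
      · have h := congrFun (congrFun heq s) (j + k)
        simp only [if_pos hs] at h
        rw [hups_wrap, hups_wrap, Nat.add_sub_cancel] at h
        omega
  · intro E hE
    have hge : ∀ s j, min j k + ups a (j - k) ≤ E s j := fun s j => by
      rw [← hups_wrap, ← hE.start]
      exact hE.monotone (Nat.zero_le s) j
    have hEmono : ∀ s, Monotone (E s) := fun s => monotone_nat_of_le_succ (hE.isUps s).mono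
    have hfin := ha.final
    have htail : ∀ s ≤ k, ∀ j, m + k ≤ j → E s j = m / 2 + k := by
      intro s hs j hj
      have h₁ := hge s j
      have h₂ := hE.le_pyr s hs j
      rw [ups_of_length_le a (by omega : a.length ≤ j - k)] at h₁
      omega
    have hhead : ∀ s, ∀ j ≤ k, E s j = j := by
      intro s j hj
      have h₁ := hge s j
      have h₂ := (hE.isUps s).le j
      omega
    have hv : ∀ s ≤ k, IsUps m fun j => E s (j + k) - k := by
      intro s hs
      refine ⟨?_, fun j => ?_, fun j => ?_, fun j hj => ?_⟩
      · simp [hhead s k le_rfl]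
      · exact Nat.sub_le_sub_right (hEmono s (by omega)) k
      · have := (hE.isUps s).step (j + k)
        rw [show j + 1 + k = j + k + 1 by omega]
        omega
      · simp only [htail s hs (j + k) (by omega), htail s hs (m + k) le_rfl]
    have hstart : toPath m (fun j => E 0 (j + k) - k) = a := by
      refine ups_injective (length_toPath _ _) ?_
      rw [ups_toPath (hv 0 (Nat.zero_le k)), hE.start]
      funext j
      rw [hups_wrap, Nat.add_sub_cancel]
      omega
    refine ⟨fun s => if s ≤ k then toPath m (fun j => E s (j + k) - k) else pyramid (m / 2),
      ⟨?_, fun s hs => if_neg (by omega), fun s hs => ?_⟩, ?_⟩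
    · simpa using hstart
    · dsimp only
      rw [if_pos (by omega : s ≤ k), pathLe_iff]
      split_ifs with hs'
      · refine ⟨by simp, fun j => ?_⟩
        rw [ups_toPath (hv s (by omega)), ups_toPath (hv _ hs')]
        exact Nat.sub_le_sub_right (hE.mono s _) k
      · refine ⟨by rw [length_toPath, length_pyramid, hm2], fun j => ?_⟩
        rw [ups_toPath (hv s (by omega)), ups_pyramid]
        have h₁ := hE.le_pyr s (by omega) (j + k)
        have h₂ := (hE.isUps s).le (j + k)
        dsimp only
        omega
    · funext s j
      dsimp only
      split_ifs with hs
      · rw [hups_wrap, ups_toPath (hv s hs)]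
        dsimp only
        rcases le_total j k with hj | hj
        · rw [Nat.sub_eq_zero_of_le hj, zero_add, hhead s k le_rfl, hhead s j hj]
          omega
        · have := hge s j
          rw [Nat.sub_add_cancel hj]
          omega
      · dsimp only
        rcases le_total j (m + 2 * k) with hj | hj
        · rw [hE.top s (by omega) j hj]; omega
        · rw [(hE.isUps s).const j hj, hE.top s (by omega) _ le_rfl]; omega

/-- If the Dyck path `a` is a product of pyramids, then for
every `k ≥ 0`, `f(u^k a d^k) = ζ^{k+1}(a, u^{|a|/2} d^{|a|/2})`, the number of
multichains of length `k+1` from `a` to the pyramid of the same length. -/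
theorem statement17 (a : BinPath) (hA : ∃ L : List ℕ, a = (L.map pyramid).flatten)
    (k : ℕ) :
    fPath (List.replicate k true ++ a ++ List.replicate k false)
      = zetaPow (k + 1) a (pyramid (a.length / 2)) := by
  obtain ⟨L, rfl⟩ := hA
  have h := isPyramidProduct_flatten L
  rw [fPath_eq_ncard (length_wrap k _) (h.isBase k), ncard_isSmallChain (h.isBase k),
    zetaPow_eq_ncard h]
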